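/- arXiv:1908.07383 — 2 statements merged into one kernel-verified Lean document; each statement's English description precedes it below -/
import Mathlib

section
/- Let f be a transcendental self-map of ℂ*, let e ∈ {0,∞}^ℕ, and let U be a wandering domain of f with U ⊆ Ĩ_e(f). Then ∂U ∩ Ĩ_e(f) ≠ ∅, where ∂U is the boundary of U in ℂ*; in particular ∂U ∩ I_e(f) ≠ ∅. -/
open Complex Topology Filter Set Function OnePoint

noncomputable section

/-- The chordal (spherical) distance on the Riemann sphere, restricted to finite points. -/
def chordalDist (z w : ℂ) : ℝ :=
  ‖z - w‖ / Real.sqrt ((1 + ‖z‖ ^ 2) * (1 + ‖w‖ ^ 2))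

/-- A transcendental self-map of `ℂ* = ℂ \ {0}`: a holomorphic self-map of the punctured
plane with essential singularities at `0` and `∞`; equivalently, on `ℂ*` it has the form
`z ^ m * exp (g z + h z⁻¹)` for some `m : ℤ` and nonconstant entire functions `g, h`. -/
def IsTranscendentalSelfMapCStar (f : ℂ → ℂ) : Prop :=
  ∃ (m : ℤ) (g h : ℂ → ℂ),
    Differentiable ℂ g ∧ Differentiable ℂ h ∧
    (¬ ∃ c : ℂ, ∀ z, g z = c) ∧ (¬ ∃ c : ℂ, ∀ z, h z = c) ∧
    ∀ z : ℂ, z ≠ 0 → f z = z ^ m * Complex.exp (g z + h z⁻¹)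

/-- The escaping set `I(f)` of a self-map of the punctured plane: points whose orbit
accumulates only at `0` and `∞`. -/
def escapingSet (f : ℂ → ℂ) : Set ℂ :=
  {z | z ≠ 0 ∧ ∀ ε : ℝ, 0 < ε → ∃ N : ℕ, ∀ n ≥ N,
    ‖f^[n] z‖ < ε ∨ 1 / ε < ‖f^[n] z‖}

/-- The little escaping set `I_e(f)` with essential itinerary `e` (where `true` stands for the
symbol `∞` and `false` for the symbol `0`). -/
def littleEscapingSet (f : ℂ → ℂ) (e : ℕ → Bool) : Set ℂ :=
  {z | z ∈ escapingSet f ∧ ∃ ℓ k : ℕ, ∀ n : ℕ,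
    (1 < ‖f^[n + ℓ] z‖ ↔ e (n + k) = true)}

/-- The immediate little escaping set `Ĩ_e(f)`. -/
def immediateLittleEscapingSet (f : ℂ → ℂ) (e : ℕ → Bool) : Set ℂ :=
  {z | z ∈ escapingSet f ∧ ∃ ℓ : ℕ, ∀ n : ℕ,
    (1 < ‖f^[n + ℓ] z‖ ↔ e (n + ℓ) = true)}

/-- The Fatou set of a self-map of the punctured plane: points of `ℂ*` with a neighbourhood
(inside `ℂ*`) on which the family of iterates is equicontinuous w.r.t. the chordal metric. -/
def FatouSet (f : ℂ → ℂ) : Set ℂ :=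
  {z | z ≠ 0 ∧ ∃ U : Set ℂ, IsOpen U ∧ z ∈ U ∧ (∀ w ∈ U, w ≠ 0) ∧
    ∀ w ∈ U, ∀ ε : ℝ, 0 < ε → ∃ δ : ℝ, 0 < δ ∧ ∀ w' ∈ U,
      chordalDist w w' < δ → ∀ n : ℕ, chordalDist (f^[n] w) (f^[n] w') < ε}

/-- The Julia set `J(f) = ℂ* \ F(f)`. -/
def JuliaSet (f : ℂ → ℂ) : Set ℂ := {z : ℂ | z ≠ 0} \ FatouSet f

/-- A Fatou component: a connected component of the Fatou set. -/
def IsFatouComponent (f : ℂ → ℂ) (U : Set ℂ) : Prop :=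
  ∃ z ∈ FatouSet f, U = connectedComponentIn (FatouSet f) z

/-- A wandering domain: a Fatou component `U` such that the Fatou components containing the
iterated images `fⁿ(U)` are pairwise distinct. -/
def IsWanderingDomain (f : ℂ → ℂ) (U : Set ℂ) : Prop :=
  IsFatouComponent f U ∧ ∃ V : ℕ → Set ℂ, V 0 = U ∧
    (∀ n, IsFatouComponent f (V n)) ∧
    (∀ n, f '' V n ⊆ V (n + 1)) ∧ Function.Injective V

/-- A set is bounded in `ℂ*` if it lies in some closed annulus `{r ≤ |z| ≤ R}`. -/
def BoundedInCStar (X : Set ℂ) : Prop :=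
  ∃ r R : ℝ, 0 < r ∧ r ≤ R ∧ X ⊆ {z : ℂ | r ≤ ‖z‖ ∧ ‖z‖ ≤ R}

/-- The boundary of a subset of `ℂ*` taken in `ℂ*`. -/
def boundaryInCStar (G : Set ℂ) : Set ℂ := frontier G \ {0}

/-- The set `I(f) ∪ {0, ∞}` regarded as a subset of the Riemann sphere `ℂ̂ = ℂ ∪ {∞}`. -/
def escapingSphere (f : ℂ → ℂ) : Set (OnePoint ℂ) :=
  ((fun z : ℂ => (z : OnePoint ℂ)) '' escapingSet f) ∪ {((0 : ℂ) : OnePoint ℂ), ∞}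

/-- The set `I_e(f) ∪ {0, ∞}` regarded as a subset of the Riemann sphere. -/
def littleEscapingSphere (f : ℂ → ℂ) (e : ℕ → Bool) : Set (OnePoint ℂ) :=
  ((fun z : ℂ => (z : OnePoint ℂ)) '' littleEscapingSet f e) ∪ {((0 : ℂ) : OnePoint ℂ), ∞}

/-- A subset of the sphere has exactly two connected components. -/
def HasExactlyTwoComponents (K : Set (OnePoint ℂ)) : Prop :=
  ∃ x ∈ K, ∃ y ∈ K, connectedComponentIn K x ≠ connectedComponentIn K y ∧
    ∀ z ∈ K, connectedComponentIn K z = connectedComponentIn K x ∨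
      connectedComponentIn K z = connectedComponentIn K y

/-- A domain `U ⊆ ℂ*` is doubly connected if its complement in the Riemann sphere has
exactly two connected components. -/
def DoublyConnected (U : Set ℂ) : Prop :=
  HasExactlyTwoComponents (((fun z : ℂ => (z : OnePoint ℂ)) '' U)ᶜ)

/-- A transcendental entire function. -/
def IsTranscendentalEntire (f : ℂ → ℂ) : Prop :=
  Differentiable ℂ f ∧ ¬ ∃ p : Polynomial ℂ, ∀ z, f z = p.eval z

/-- The Fatou set of an entire function. -/
def FatouSetEntire (f : ℂ → ℂ) : Set ℂ :=
  {z | ∃ U : Set ℂ, IsOpen U ∧ z ∈ U ∧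
    ∀ w ∈ U, ∀ ε : ℝ, 0 < ε → ∃ δ : ℝ, 0 < δ ∧ ∀ w' ∈ U,
      chordalDist w w' < δ → ∀ n : ℕ, chordalDist (f^[n] w) (f^[n] w') < ε}

/-- The Julia set of an entire function. -/
def JuliaSetEntire (f : ℂ → ℂ) : Set ℂ := (FatouSetEntire f)ᶜ

/-- `f` has a finite asymptotic value. -/
def HasFiniteAsymptoticValue (f : ℂ → ℂ) : Prop :=
  ∃ (a : ℂ) (γ : ℝ → ℂ), ContinuousOn γ (Set.Ici (0 : ℝ)) ∧
    Tendsto (fun t => ‖γ t‖) atTop atTop ∧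
    Tendsto (fun t => f (γ t)) atTop (nhds a)
/-- A real-valued function that is continuous on `U` and has the mean value property on every
circle bounding a closed disc inside `U`. -/
def HasMeanValueOn (g : ℂ → ℝ) (U : Set ℂ) : Prop :=
  ContinuousOn g U ∧ ∀ (c : ℂ) (r : ℝ), 0 < r → Metric.closedBall c r ⊆ U →
    Real.circleAverage g c r = g c

lemma ContinuousOn.circleIntegrable_of_closedBall_subset {g : ℂ → ℝ} {U : Set ℂ}
    (hg : ContinuousOn g U) {c : ℂ} {r : ℝ} (hr : 0 < r) (hc : Metric.closedBall c r ⊆ U) :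
    CircleIntegrable g c r :=
  (hg.mono (Metric.sphere_subset_closedBall.trans hc)).circleIntegrable hr.le

namespace HasMeanValueOn

variable {g g₁ g₂ : ℂ → ℝ} {U : Set ℂ}

lemma const (k : ℝ) : HasMeanValueOn (fun _ => k) U :=
  ⟨continuousOn_const, fun c r _ _ => Real.circleAverage_const k c r⟩

lemma add (h₁ : HasMeanValueOn g₁ U) (h₂ : HasMeanValueOn g₂ U) :
    HasMeanValueOn (fun z => g₁ z + g₂ z) U := by
  refine ⟨h₁.1.add h₂.1, fun c r hr hc => ?_⟩
  rw [Real.circleAverage_fun_add (h₁.1.circleIntegrable_of_closedBall_subset hr hc)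
    (h₂.1.circleIntegrable_of_closedBall_subset hr hc), h₁.2 c r hr hc, h₂.2 c r hr hc]

lemma const_mul (h : HasMeanValueOn g U) (k : ℝ) : HasMeanValueOn (fun z => k * g z) U := by
  refine ⟨continuousOn_const.mul h.1, fun c r hr hc => ?_⟩
  have := Real.circleAverage_fun_smul (a := k) (f := g) (c := c) (R := r)
  simp only [smul_eq_mul] at this
  rw [this, h.2 c r hr hc]

lemma sub (h₁ : HasMeanValueOn g₁ U) (h₂ : HasMeanValueOn g₂ U) :
    HasMeanValueOn (fun z => g₁ z - g₂ z) U := by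
  have := h₁.add (h₂.const_mul (-1))
  simpa [sub_eq_add_neg] using this

lemma sum {ι : Type*} (s : Finset ι) {G : ι → ℂ → ℝ} (h : ∀ i ∈ s, HasMeanValueOn (G i) U) :
    HasMeanValueOn (fun z => ∑ i ∈ s, G i z) U := by
  refine ⟨continuousOn_finsetSum s fun i hi => (h i hi).1, fun c r hr hc => ?_⟩
  rw [Real.circleAverage_fun_sum fun i hi => (h i hi).1.circleIntegrable_of_closedBall_subset hr hc]
  exact Finset.sum_congr rfl fun i hi => (h i hi).2 c r hr hc

lemma log_norm {F : ℂ → ℂ} (hF : AnalyticOnNhd ℂ F U) (h0 : ∀ z ∈ U, F z ≠ 0) :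
    HasMeanValueOn (fun z => Real.log ‖F z‖) U := by
  refine ⟨hF.continuousOn.norm.log fun z hz => norm_ne_zero_iff.2 (h0 z hz), fun c r hr hc => ?_⟩
  rw [← abs_of_pos hr] at hc
  exact AnalyticOnNhd.circleAverage_log_norm_of_ne_zero (hF.mono hc) fun u hu => h0 u (hc hu)

lemma setIntegral (hU : IsOpen U) {B : Set ℝ} (hB : IsCompact B) {G : ℝ → ℂ → ℝ}
    (hG : ContinuousOn (uncurry G) (B ×ˢ U)) (h : ∀ t ∈ B, HasMeanValueOn (G t) U) :
    HasMeanValueOn (fun z => ∫ t in B, G t z) U := by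
  have hcont : ContinuousOn (fun z => ∫ t in B, G t z) U := by
    intro z hz
    obtain ⟨r, hr, hrU⟩ := Metric.nhds_basis_closedBall.mem_iff.1 (hU.mem_nhds hz)
    have hGr := hG.mono (prod_mono_right hrU : B ×ˢ Metric.closedBall z r ⊆ B ×ˢ U)
    obtain ⟨C, hC⟩ := (hB.prod (isCompact_closedBall z r)).exists_bound_of_continuousOn hGr
    have key : ContinuousOn (fun z => ∫ t in B, G t z) (Metric.closedBall z r) := by
      refine MeasureTheory.continuousOn_of_dominated (bound := fun _ => C) ?_ ?_ ?_ ?_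
      · intro x hx
        refine ContinuousOn.aestronglyMeasurable ?_ hB.measurableSet
        exact hGr.comp (f := fun t => (t, x)) (by fun_prop) fun t ht => ⟨ht, hx⟩
      · intro x hx
        exact MeasureTheory.ae_restrict_of_forall_mem hB.measurableSet fun t ht => hC (t, x) ⟨ht, hx⟩
      · exact (continuous_const.continuousOn (s := B)).integrableOn_compact hB
      · refine MeasureTheory.ae_restrict_of_forall_mem hB.measurableSet fun t ht => ?_
        exact hGr.comp (f := fun x => (t, x)) (by fun_prop) fun x hx => ⟨ht, hx⟩
    exact (key.continuousAt (Metric.closedBall_mem_nhds z hr)).continuousWithinAt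
  refine ⟨hcont, fun c r hr hc => ?_⟩
  have hmap : ∀ θ, circleMap c r θ ∈ U := fun θ => hc (circleMap_mem_closedBall c hr.le θ)
  have hint : MeasureTheory.Integrable (uncurry fun θ t => G t (circleMap c r θ))
      ((MeasureTheory.volume.restrict (Ioc 0 (2 * Real.pi))).prod
        (MeasureTheory.volume.restrict B)) := by
    rw [MeasureTheory.Measure.prod_restrict]
    have : ContinuousOn (uncurry fun θ t => G t (circleMap c r θ))
        (Icc 0 (2 * Real.pi) ×ˢ B) := by
      refine hG.comp (f := fun p : ℝ × ℝ => (p.2, circleMap c r p.1)) ?_ fun p hp => ⟨hp.2, hmap _⟩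
      exact (continuous_snd.prodMk ((continuous_circleMap c r).comp continuous_fst)).continuousOn
    exact (this.integrableOn_compact (isCompact_Icc.prod hB)).mono_set
      (prod_mono_left Ioc_subset_Icc_self)
  rw [Real.circleAverage_def, intervalIntegral.integral_of_le Real.two_pi_pos.le,
    MeasureTheory.integral_integral_swap hint, ← MeasureTheory.integral_smul]
  refine MeasureTheory.setIntegral_congr_fun hB.measurableSet fun t ht => ?_
  have := (h t ht).2 c r hr hc
  rwa [Real.circleAverage_def, intervalIntegral.integral_of_le Real.two_pi_pos.le] at this

lemma eqOn_sphere_of_isMin (h : HasMeanValueOn g U) {c : ℂ} {r : ℝ} (hr : 0 < r)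
    (hc : Metric.closedBall c r ⊆ U) (hmin : ∀ z ∈ U, g c ≤ g z) {z : ℂ}
    (hz : z ∈ Metric.sphere c r) : g z = g c := by
  have h' := h.sub (const (g c))
  have havg := h'.2 c r hr hc
  rw [Real.circleAverage_def, show (fun z => g z - g c) c = 0 from sub_self _, smul_eq_mul, mul_eq_zero,
    or_iff_right (inv_ne_zero Real.two_pi_pos.ne')] at havg
  have hmap : ∀ θ, circleMap c r θ ∈ U := fun θ => hc (circleMap_mem_closedBall c hr.le θ)
  obtain ⟨θ, hθ, rfl⟩ : ∃ θ ∈ Ioc 0 (2 * Real.pi), circleMap c r θ = z := by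
    rw [← abs_of_pos hr, ← image_circleMap_Ioc] at hz
    exact hz
  by_contra hne
  refine (intervalIntegral.integral_pos (f := fun θ => g (circleMap c r θ) - g c)
    Real.two_pi_pos ?_ (fun x _ => sub_nonneg.2 (hmin _ (hmap x)))
    ⟨θ, Ioc_subset_Icc_self hθ, sub_pos.2 ((hmin _ (hmap θ)).lt_of_ne' hne)⟩).ne' havg
  exact h'.1.comp (continuous_circleMap c r).continuousOn fun x _ => hmap x

/-- Minimum principle: a function with the mean value property has no nonempty compact
sublevel set. -/
lemma not_isCompact_sublevel (h : HasMeanValueOn g U) (hU : IsOpen U) {z₀ : ℂ} (hz₀ : z₀ ∈ U) :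
    ¬ IsCompact {z | z ∈ U ∧ g z ≤ g z₀} := by
  intro hK
  set K := {z | z ∈ U ∧ g z ≤ g z₀} with hKdef
  have hKU : K ⊆ U := fun z hz => hz.1
  obtain ⟨m, hm, hmin⟩ := hK.exists_isMinOn ⟨z₀, hz₀, le_rfl⟩ (h.1.mono hKU)
  have hmin' : ∀ z ∈ U, g m ≤ g z := fun z hz => by
    by_cases hzK : z ∈ K
    · exact hmin hzK
    · exact hm.2.trans (not_le.1 fun hle => hzK ⟨hz, hle⟩).le
  set M := {z | z ∈ K ∧ g z ≤ g m} with hM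
  have hMclosed : IsClosed M := (h.1.mono hKU).preimage_isClosed_of_isClosed hK.isClosed isClosed_Iic
  have hMopen : IsOpen M := by
    rw [Metric.isOpen_iff]
    intro z hz
    obtain ⟨r, hr, hrU⟩ := Metric.nhds_basis_ball.mem_iff.1 (hU.mem_nhds (hKU hz.1))
    have hzm : g z = g m := le_antisymm hz.2 (hmin' z (hKU hz.1))
    refine ⟨r, hr, fun w hw => ?_⟩
    have hwm : g w = g m := by
      rcases eq_or_ne w z with rfl | hwz
      · exact hzm
      · rw [← hzm]
        refine h.eqOn_sphere_of_isMin (dist_pos.2 hwz) ?_ (fun x hx => hzm ▸ hmin' x hx)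
          (Metric.mem_sphere.2 rfl)
        exact (Metric.closedBall_subset_ball (Metric.mem_ball.1 hw)).trans hrU
    exact ⟨⟨hrU hw, hwm.le.trans hm.2⟩, hwm.le⟩
  have hMuniv : M = univ := IsClopen.eq_univ ⟨hMclosed, hMopen⟩ ⟨m, hm, le_rfl⟩
  exact noncompact_univ ℂ (hMuniv ▸ hK.of_isClosed_subset hMclosed fun z hz => hz.1)

end HasMeanValueOn

/-- The angles in `[0, 2π]` at which the circle of radius `R` about `0` meets `W`. -/
def circleAngles (R : ℝ) (W : Set ℂ) : Set ℝ := {θ ∈ Icc 0 (2 * Real.pi) | circleMap 0 R θ ∈ W}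

/-- The total angle under which the circle of radius `R` about `0` meets `W`. -/
def circleAngle (R : ℝ) (W : Set ℂ) : ℝ := (MeasureTheory.volume (circleAngles R W)).toReal

/-- A function of `w`, harmonic on `W \ {0}`, which is nonnegative on `W`, at least `2π log 2` on
the points of `W` of modulus less than `R / 2`, and bounded by a multiple of `circleAngle R W`
at points of modulus at least `2R`. -/
def arcPotential (R : ℝ) (W : Set ℂ) (w : ℂ) : ℝ :=
  (∫ θ in circleAngles R Wᶜ, (Real.log ‖w - circleMap 0 R θ‖ - Real.log ‖w‖)) +
    circleAngle R W * Real.log 3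

section arcPotential

open MeasureTheory

variable {R : ℝ} {W : Set ℂ}

lemma isCompact_circleAngles (hW : IsClosed W) : IsCompact (circleAngles R W) :=
  isCompact_Icc.inter_right (hW.preimage (continuous_circleMap 0 R))

lemma measurableSet_circleAngles (hW : IsOpen W) : MeasurableSet (circleAngles R W) :=
  measurableSet_Icc.inter (hW.preimage (continuous_circleMap 0 R)).measurableSet

lemma circleAngles_union_compl : circleAngles R W ∪ circleAngles R Wᶜ = Icc 0 (2 * Real.pi) := by
  ext θ
  simp only [circleAngles, mem_union, mem_ofPred_eq, mem_compl_iff]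
  tauto

lemma volume_circleAngles_le : volume (circleAngles R W) ≤ ENNReal.ofReal (2 * Real.pi) :=
  (measure_mono (sep_subset _ _)).trans (by rw [Real.volume_Icc, sub_zero])

lemma volume_circleAngles_ne_top : volume (circleAngles R W) ≠ ⊤ :=
  (volume_circleAngles_le.trans_lt ENNReal.ofReal_lt_top).ne

lemma circleAngle_nonneg : 0 ≤ circleAngle R W := ENNReal.toReal_nonneg

lemma circleAngle_le : circleAngle R W ≤ 2 * Real.pi :=
  ENNReal.toReal_le_of_le_ofReal Real.two_pi_pos.le volume_circleAngles_le

lemma integrableOn_log_norm_sub_circleMap (R : ℝ) (w : ℂ) :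
    IntegrableOn (fun θ => Real.log ‖w - circleMap 0 R θ‖ - Real.log ‖w‖)
      (Icc 0 (2 * Real.pi)) := by
  have h := circleIntegrable_log_norm_sub_const (a := w) (c := 0) R
  rw [CircleIntegrable, intervalIntegrable_iff_integrableOn_Icc_of_le Real.two_pi_pos.le] at h
  simp only [norm_sub_rev _ w] at h
  exact h.sub (integrableOn_const isCompact_Icc.measure_lt_top.ne)

lemma setIntegral_log_norm_sub_circleMap (hR : 0 < R) {w : ℂ} :
    ∫ θ in Icc 0 (2 * Real.pi), (Real.log ‖w - circleMap 0 R θ‖ - Real.log ‖w‖) =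
      2 * Real.pi * (Real.log R + Real.posLog (R⁻¹ * ‖w‖) - Real.log ‖w‖) := by
  have h := circleIntegrable_log_norm_sub_const (a := w) (c := 0) R
  have havg := circleAverage_log_norm_sub_const_eq_log_radius_add_posLog (a := w) (c := 0) hR.ne'
  rw [Real.circleAverage_def, intervalIntegral.integral_of_le Real.two_pi_pos.le,
    ← integral_Icc_eq_integral_Ioc, smul_eq_mul, inv_mul_eq_iff_eq_mul₀ Real.two_pi_pos.ne',
    zero_sub, norm_neg] at havg
  rw [CircleIntegrable, intervalIntegrable_iff_integrableOn_Icc_of_le Real.two_pi_pos.le] at h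
  simp only [norm_sub_rev _ w] at h havg
  rw [integral_sub h (integrableOn_const isCompact_Icc.measure_lt_top.ne), havg, setIntegral_const, measureReal_def,
    Real.volume_Icc, sub_zero, ENNReal.toReal_ofReal Real.two_pi_pos.le, smul_eq_mul]
  ring

lemma arcPotential_eq (hW : IsOpen W) (hR : 0 < R) (w : ℂ) :
    arcPotential R W w =
      2 * Real.pi * (Real.log R + Real.posLog (R⁻¹ * ‖w‖) - Real.log ‖w‖) +
      ∫ θ in circleAngles R W,
        (Real.log 3 - (Real.log ‖w - circleMap 0 R θ‖ - Real.log ‖w‖)) := by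
  have hint := integrableOn_log_norm_sub_circleMap R w
  have hdisj : Disjoint (circleAngles R W) (circleAngles R Wᶜ) :=
    Set.disjoint_left.2 fun θ h h' => h'.2 h.2
  have hsplit := setIntegral_union hdisj (isCompact_circleAngles hW.isClosed_compl).measurableSet
    (hint.mono_set (sep_subset _ _)) (hint.mono_set (sep_subset _ _))
  rw [circleAngles_union_compl, setIntegral_log_norm_sub_circleMap hR] at hsplit
  have hconst : IntegrableOn (fun _ => Real.log 3) (circleAngles R W) :=
    integrableOn_const volume_circleAngles_ne_top
  rw [integral_sub hconst (hint.mono_set (sep_subset _ _)), setIntegral_const, hsplit, arcPotential, circleAngle,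
    measureReal_def, smul_eq_mul]
  ring

lemma circleAngle_mul_le_setIntegral {c : ℝ} {φ : ℝ → ℝ} (hW : IsOpen W)
    (hφ : IntegrableOn φ (circleAngles R W)) (h : ∀ θ, c ≤ φ θ) :
    circleAngle R W * c ≤ ∫ θ in circleAngles R W, φ θ := by
  have := setIntegral_mono_on (integrableOn_const volume_circleAngles_ne_top) hφ
    (measurableSet_circleAngles hW) (fun θ _ => h θ)
  rwa [setIntegral_const, smul_eq_mul] at this

lemma setIntegral_le_circleAngle_mul {c : ℝ} {φ : ℝ → ℝ} (hW : IsOpen W)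
    (hφ : IntegrableOn φ (circleAngles R W)) (h : ∀ θ, φ θ ≤ c) :
    ∫ θ in circleAngles R W, φ θ ≤ circleAngle R W * c := by
  have := setIntegral_mono_on hφ (integrableOn_const volume_circleAngles_ne_top)
    (measurableSet_circleAngles hW) (fun θ _ => h θ)
  rwa [setIntegral_const, smul_eq_mul] at this

lemma integrableOn_circleAngles_arcPotential (w : ℂ) :
    IntegrableOn (fun θ => Real.log 3 - (Real.log ‖w - circleMap 0 R θ‖ - Real.log ‖w‖))
      (circleAngles R W) :=
  (integrableOn_const volume_circleAngles_ne_top).sub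
    ((integrableOn_log_norm_sub_circleMap R w).mono_set (sep_subset _ _))

lemma norm_sub_circleMap_zero_le (hR : 0 < R) (w : ℂ) (θ : ℝ) :
    ‖w - circleMap 0 R θ‖ ≤ ‖w‖ + R := by
  simpa [abs_of_pos hR] using norm_sub_le w (circleMap 0 R θ)

lemma le_norm_sub_circleMap_zero (hR : 0 < R) (w : ℂ) (θ : ℝ) :
    R - ‖w‖ ≤ ‖w - circleMap 0 R θ‖ ∧ ‖w‖ - R ≤ ‖w - circleMap 0 R θ‖ := by
  constructor
  · simpa [abs_of_pos hR, norm_sub_rev] using norm_sub_norm_le (circleMap 0 R θ) w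
  · simpa [abs_of_pos hR] using norm_sub_norm_le w (circleMap 0 R θ)

lemma le_arcPotential_of_norm_lt (hW : IsOpen W) (hR : 0 < R) {w : ℂ} (hw0 : w ≠ 0)
    (hw : ‖w‖ < R / 2) : 2 * Real.pi * Real.log 2 ≤ arcPotential R W w := by
  have hw0' : 0 < ‖w‖ := norm_pos_iff.2 hw0
  have hlog : Real.log ‖w‖ ≤ Real.log R - Real.log 2 := by
    rw [← Real.log_div hR.ne' two_ne_zero]
    exact Real.log_le_log hw0' hw.le
  have hpos : Real.posLog (R⁻¹ * ‖w‖) = 0 := by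
    rw [Real.posLog_eq_zero_iff, abs_of_pos (by positivity), inv_mul_le_iff₀ hR]
    linarith
  have hle : circleAngle R W * (Real.log 2 - (Real.log R - Real.log ‖w‖)) ≤
      ∫ θ in circleAngles R W,
        (Real.log 3 - (Real.log ‖w - circleMap 0 R θ‖ - Real.log ‖w‖)) := by
    refine circleAngle_mul_le_setIntegral hW (integrableOn_circleAngles_arcPotential w) fun θ => ?_
    have h1 := norm_sub_circleMap_zero_le hR w θ
    have h2 := (le_norm_sub_circleMap_zero hR w θ).1
    have h3 : Real.log ‖w - circleMap 0 R θ‖ ≤ Real.log 3 + Real.log R - Real.log 2 := by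
      rw [← Real.log_mul three_ne_zero hR.ne', ← Real.log_div (by positivity) two_ne_zero]
      exact Real.log_le_log (by linarith) (by linarith)
    linarith
  rw [arcPotential_eq hW hR, hpos]
  have := mul_le_mul_of_nonpos_right (circleAngle_le (R := R) (W := W))
    (show Real.log 2 - (Real.log R - Real.log ‖w‖) ≤ 0 by linarith)
  linarith

lemma arcPotential_nonneg (hW : IsOpen W) (hR : 2 ≤ R) {w : ℂ} (hw0 : w ≠ 0) :
    0 ≤ arcPotential R W w := by
  have hR0 : 0 < R := by linarith
  rcases lt_or_ge ‖w‖ (R / 2) with hw | hw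
  · exact le_trans (mul_nonneg Real.two_pi_pos.le (Real.log_nonneg one_le_two))
      (le_arcPotential_of_norm_lt hW hR0 hw0 hw)
  have hw0' : 0 < ‖w‖ := norm_pos_iff.2 hw0
  have hle : circleAngle R W * 0 ≤ ∫ θ in circleAngles R W,
      (Real.log 3 - (Real.log ‖w - circleMap 0 R θ‖ - Real.log ‖w‖)) := by
    refine circleAngle_mul_le_setIntegral hW (integrableOn_circleAngles_arcPotential w) fun θ => ?_
    have h1 := norm_sub_circleMap_zero_le hR0 w θ
    have h3 : Real.log ‖w - circleMap 0 R θ‖ ≤ Real.log 3 + Real.log ‖w‖ := by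
      rw [← Real.log_mul three_ne_zero hw0'.ne']
      rcases (norm_nonneg (w - circleMap 0 R θ)).eq_or_lt with h0 | h0
      · rw [← h0, Real.log_zero]
        exact Real.log_nonneg (by linarith)
      · exact Real.log_le_log h0 (by linarith)
    linarith
  rw [arcPotential_eq hW hR0]
  have hpos : Real.log (R⁻¹ * ‖w‖) ≤ Real.posLog (R⁻¹ * ‖w‖) := le_max_right _ _
  rw [Real.log_mul (by positivity) hw0'.ne', Real.log_inv] at hpos
  have := mul_nonneg Real.two_pi_pos.le
    (show 0 ≤ Real.log R + Real.posLog (R⁻¹ * ‖w‖) - Real.log ‖w‖ by linarith)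
  linarith

lemma arcPotential_le (hW : IsOpen W) (hR : 0 < R) {w : ℂ} (hw : 2 * R ≤ ‖w‖) :
    arcPotential R W w ≤ circleAngle R W * Real.log 6 := by
  have hw0 : 0 < ‖w‖ := by linarith
  have hle : ∫ θ in circleAngles R W,
      (Real.log 3 - (Real.log ‖w - circleMap 0 R θ‖ - Real.log ‖w‖)) ≤
        circleAngle R W * Real.log 6 := by
    refine setIntegral_le_circleAngle_mul hW (integrableOn_circleAngles_arcPotential w) fun θ => ?_
    have h2 := (le_norm_sub_circleMap_zero hR w θ).2
    have h3 : Real.log ‖w‖ - Real.log 2 ≤ Real.log ‖w - circleMap 0 R θ‖ := by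
      rw [← Real.log_div hw0.ne' two_ne_zero]
      exact Real.log_le_log (by linarith) (by linarith)
    have h6 : Real.log 6 = Real.log 3 + Real.log 2 := by
      rw [← Real.log_mul three_ne_zero two_ne_zero]; norm_num
    linarith
  have hpos : Real.posLog (R⁻¹ * ‖w‖) = Real.log ‖w‖ - Real.log R := by
    rw [Real.posLog_eq_log, Real.log_mul (by positivity) hw0.ne', Real.log_inv]
    · ring
    · rw [abs_of_pos (by positivity), inv_mul_eq_div, one_le_div hR]
      linarith
  rw [arcPotential_eq hW hR, hpos]
  linarith

lemma hasMeanValueOn_arcPotential_comp {U : Set ℂ} (hU : IsOpen U) (hW : IsOpen W) {F : ℂ → ℂ}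
    (hF : AnalyticOnNhd ℂ F U) (h0 : ∀ z ∈ U, F z ≠ 0) (hFW : MapsTo F U W) :
    HasMeanValueOn (fun z => arcPotential R W (F z)) U := by
  refine HasMeanValueOn.add ?_ (HasMeanValueOn.const _)
  have hne : ∀ θ ∈ circleAngles R Wᶜ, ∀ z ∈ U, F z - circleMap 0 R θ ≠ 0 := fun θ hθ z hz h =>
    hθ.2 (sub_eq_zero.1 h ▸ hFW hz)
  have hFs : ContinuousOn (fun p : ℝ × ℂ => F p.2) (circleAngles R Wᶜ ×ˢ U) :=
    hF.continuousOn.comp continuousOn_snd fun p hp => hp.2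
  refine HasMeanValueOn.setIntegral hU (isCompact_circleAngles hW.isClosed_compl) ?_ ?_
  · refine ContinuousOn.sub ?_ (hFs.norm.log fun p hp => norm_ne_zero_iff.2 (h0 _ hp.2))
    refine ContinuousOn.log ?_ fun p hp => norm_ne_zero_iff.2 (hne _ hp.1 _ hp.2)
    exact (hFs.sub ((continuous_circleMap 0 R).comp continuous_fst).continuousOn).norm
  · exact fun θ hθ => (HasMeanValueOn.log_norm (hF.sub analyticOnNhd_const) (hne θ hθ)).sub
      (HasMeanValueOn.log_norm hF h0)

lemma tsum_volume_circleAngles_le {V : ℕ → Set ℂ} (hV : ∀ n, IsOpen (V n))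
    (hd : Pairwise (Function.onFun Disjoint V)) (R : ℝ) :
    ∑' n, volume (circleAngles R (V n)) ≤ ENNReal.ofReal (2 * Real.pi) := by
  rw [← measure_iUnion _ fun n => measurableSet_circleAngles (hV n)]
  · refine (measure_mono (iUnion_subset fun n => sep_subset _ _)).trans ?_
    rw [Real.volume_Icc, sub_zero]
  · exact fun i j hij => Set.disjoint_left.2 fun θ h h' =>
      Set.disjoint_left.1 (hd hij) h.2 h'.2

end arcPotential

section puncturedPlane

variable {a : ℂ} {r : ℝ}

/-- Off a disc about `a ≠ 0`, the function `|z - a|² / |z|` is bounded below. -/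
lemma le_sq_norm_sub_div_norm (hr : 0 < r) {z : ℂ} (hz0 : z ≠ 0) (hz : r ≤ ‖z - a‖) :
    1 ≤ (r + ‖a‖) / r ^ 2 * (‖z - a‖ ^ 2 / ‖z‖) := by
  have hz' : 0 < ‖z‖ := norm_pos_iff.2 hz0
  have htri : ‖z‖ ≤ ‖z - a‖ + ‖a‖ := norm_le_norm_sub_add z a
  rw [div_mul_div_comm, one_le_div (by positivity)]
  have h1 : r * ‖a‖ ≤ ‖z - a‖ * ‖a‖ := mul_le_mul_of_nonneg_right hz (norm_nonneg _)
  have h2 : r * (‖z - a‖ * r + r * ‖a‖) ≤ ‖z - a‖ * (‖z - a‖ * r + ‖z - a‖ * ‖a‖) := by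
    gcongr
  nlinarith [mul_le_mul_of_nonneg_left htri (sq_nonneg r)]

/-- The sublevel sets of `|z - a|² / |z|` in the punctured plane are compact. -/
lemma isCompact_sq_norm_sub_le (a : ℂ) (D : ℝ) : IsCompact {z : ℂ | ‖z - a‖ ^ 2 ≤ D * ‖z‖} := by
  refine Metric.isCompact_of_isClosed_isBounded
    (isClosed_le (by fun_prop) (by fun_prop)) (isBounded_iff_forall_norm_le.2 ?_)
  refine ⟨|D| + 2 * ‖a‖ + 1, fun z hz => ?_⟩
  have hz' : ‖z - a‖ ^ 2 ≤ D * ‖z‖ := hz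
  have htri : ‖z‖ - ‖a‖ ≤ ‖z - a‖ := norm_sub_norm_le z a
  by_contra! hlt
  have ha := norm_nonneg a
  have hD := le_abs_self D
  have hD0 := abs_nonneg D
  have h1 : (‖z‖ - ‖a‖) ^ 2 ≤ ‖z - a‖ ^ 2 := pow_le_pow_left₀ (by linarith) htri 2
  nlinarith [mul_le_mul_of_nonneg_right hD (norm_nonneg z), mul_nonneg (norm_nonneg z) ha,
    mul_nonneg (norm_nonneg z) (sub_nonneg.2 hlt.le)]

end puncturedPlane

/-- Let `F n` map `U` into `W n`, where the total angle under which any given circle about `0`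
meets the sets `W n` is finite. If `F n → ∞` pointwise on `U`, then this also holds at some
boundary point of `U` in the punctured plane. -/
theorem exists_mem_frontier_tendsto_norm_atTop {U : Set ℂ} (hU : IsOpen U) (hUne : U.Nonempty)
    (hU0 : (0 : ℂ) ∉ U) {a : ℂ} {r : ℝ} (ha : a ≠ 0) (hr : 0 < r)
    (haU : Disjoint (Metric.ball a r) U) {F : ℕ → ℂ → ℂ} {W : ℕ → Set ℂ}
    (hF : ∀ n, AnalyticOnNhd ℂ (F n) {0}ᶜ) (hF0 : ∀ n z, z ≠ 0 → F n z ≠ 0)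
    (hW : ∀ n, IsOpen (W n)) (hFW : ∀ n, MapsTo (F n) U (W n))
    (hsum : ∀ R, ∑' n, MeasureTheory.volume (circleAngles R (W n)) ≠ ⊤)
    (htend : ∀ z ∈ U, Tendsto (fun n => ‖F n z‖) atTop atTop) :
    ∃ ζ ∈ frontier U, ζ ≠ 0 ∧ Tendsto (fun n => ‖F n ζ‖) atTop atTop := by
  by_contra! hcon
  obtain ⟨z₀, hz₀⟩ := hUne
  have hne0 : ∀ z ∈ U, z ≠ 0 := fun z hz h => hU0 (h ▸ hz)
  have hUsub : U ⊆ {0}ᶜ := hne0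
  set R : ℕ → ℝ := fun k => 2 ^ (k + 1) with hRdef
  have hR2 : ∀ k, 2 ≤ R k := fun k => by
    simpa [hRdef] using le_self_pow₀ (one_le_two (α := ℝ)) (Nat.succ_ne_zero k)
  have hR0 : ∀ k, 0 < R k := fun k => by linarith [hR2 k]
  have hlog2 : 0 < Real.log 2 := Real.log_pos one_lt_two
  have hlog6 : 0 < Real.log 6 := Real.log_pos (by norm_num)
  set m₀ : ℝ := 2 * Real.pi * Real.log 2 with hm₀
  have hm₀pos : 0 < m₀ := mul_pos Real.two_pi_pos hlog2
  set η : ℝ := m₀ / (4 * Real.log 6) with hη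
  have hηpos : 0 < η := by positivity
  -- choice of starting indices
  obtain ⟨ε, hεpos, hε⟩ := ENNReal.exists_pos_sum_of_countable'
    (ε := ENNReal.ofReal η) (by simpa using hηpos) ℕ
  have hN : ∀ k, ∃ N, ∑' m, MeasureTheory.volume (circleAngles (R k) (W (m + N))) ≤ ε k ∧
      ∀ m, 2 * R k ≤ ‖F (m + N) z₀‖ := by
    intro k
    have h1 := (ENNReal.tendsto_sum_nat_add _ (hsum (R k))).eventually (ge_mem_nhds (hεpos k))
    have h2 := (htend z₀ hz₀).eventually_ge_atTop (2 * R k)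
    obtain ⟨N, hN, hN'⟩ := (h1.and (eventually_forall_ge_atTop.2 h2)).exists
    exact ⟨N, hN, fun m => hN' _ (Nat.le_add_left N m)⟩
  choose N hNsum hNge using hN
  set n : ℕ × ℕ → ℕ := fun p => p.2 + N p.1 with hn
  have htotal : ∑' p : ℕ × ℕ, MeasureTheory.volume (circleAngles (R p.1) (W (n p))) ≤
      ENNReal.ofReal η := by
    rw [ENNReal.tsum_prod (f := fun k m =>
      MeasureTheory.volume (circleAngles (R k) (W (m + N k))))]
    exact (ENNReal.tsum_le_tsum hNsum).trans hε.le
  have hfin : ∀ P : Finset (ℕ × ℕ), ∑ p ∈ P, circleAngle (R p.1) (W (n p)) ≤ η := by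
    intro P
    simp only [circleAngle]
    rw [← ENNReal.toReal_sum fun p _ => volume_circleAngles_ne_top]
    exact ENNReal.toReal_le_of_le_ofReal hηpos.le ((ENNReal.sum_le_tsum P).trans htotal)
  -- the function with logarithmic poles at `0` and `∞`
  set C : ℝ := (r + ‖a‖) / r ^ 2 with hC
  have hCpos : 0 < C := by positivity
  set v : ℂ → ℝ := fun z => Real.log C + (2 * Real.log ‖z - a‖ - Real.log ‖z‖) with hv
  have hUa : ∀ z ∈ U, r ≤ ‖z - a‖ := fun z hz => by
    by_contra! hlt
    exact Set.disjoint_left.1 haU (mem_ball_iff_norm.2 hlt) hz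
  have hane : ∀ z ∈ U, z - a ≠ 0 := fun z hz => norm_pos_iff.1 (hr.trans_le (hUa z hz))
  have hvlog : ∀ z ∈ U, v z = Real.log (C * (‖z - a‖ ^ 2 / ‖z‖)) := fun z hz => by
    have h1 := norm_ne_zero_iff.2 (hane z hz)
    have h2 := norm_ne_zero_iff.2 (hne0 z hz)
    rw [Real.log_mul hCpos.ne' (by positivity), Real.log_div (by positivity) h2, Real.log_pow]
    simp [hv]
  have hv0 : ∀ z ∈ U, 0 ≤ v z := fun z hz => by
    rw [hvlog z hz]
    exact Real.log_nonneg (le_sq_norm_sub_div_norm hr (hne0 z hz) (hUa z hz))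
  have hvMV : HasMeanValueOn v U :=
    (HasMeanValueOn.const _).add (((HasMeanValueOn.log_norm
      (analyticOnNhd_id.sub analyticOnNhd_const) hane).const_mul 2).sub
        (HasMeanValueOn.log_norm analyticOnNhd_id hne0))
  obtain ⟨δ, hδ, hδv⟩ : ∃ δ : ℝ, 0 < δ ∧ δ * v z₀ ≤ m₀ / 4 := by
    refine ⟨m₀ / (4 * (v z₀ + 1)), by have := hv0 z₀ hz₀; positivity, ?_⟩
    have := hv0 z₀ hz₀
    rw [div_mul_eq_mul_div, div_le_div_iff₀ (by positivity) (by norm_num)]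
    nlinarith
  -- compactness
  set D : ℝ := Real.exp (m₀ / δ) / C with hD
  set A : Set ℂ := {z : ℂ | ‖z - a‖ ^ 2 ≤ D * ‖z‖} with hA
  have hAc : IsCompact A := isCompact_sq_norm_sub_le a D
  have hA0 : (0 : ℂ) ∉ A := fun h => by
    have h' : ‖(0 : ℂ) - a‖ ^ 2 ≤ D * ‖(0 : ℂ)‖ := h
    rw [zero_sub, norm_neg, norm_zero, mul_zero] at h'
    exact absurd h' (not_le.2 (by positivity))
  set O : ℕ × ℕ → Set ℂ := fun p => {0}ᶜ ∩ F (n p) ⁻¹' {w | ‖w‖ < R p.1 / 2} with hO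
  have hOopen : ∀ p, IsOpen (O p) := fun p =>
    (hF (n p)).continuousOn.isOpen_inter_preimage isOpen_compl_singleton
      (isOpen_lt continuous_norm continuous_const)
  have hcover : frontier U ∩ A ⊆ ⋃ p, O p := by
    intro ζ hζ
    have hζ0 : ζ ≠ 0 := fun h => hA0 (h ▸ hζ.2)
    have hnot := hcon ζ hζ.1 hζ0
    rw [tendsto_atTop] at hnot
    obtain ⟨b, hb⟩ := not_forall.1 hnot
    obtain ⟨k, hk⟩ := pow_unbounded_of_one_lt b (one_lt_two (α := ℝ))
    obtain ⟨j, hj, hjb⟩ := (Filter.frequently_atTop.1 (Filter.not_eventually.1 hb)) (N k)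
    refine mem_iUnion.2 ⟨(k, j - N k), hζ0, ?_⟩
    have : n (k, j - N k) = j := Nat.sub_add_cancel hj
    change ‖F (n (k, j - N k)) ζ‖ < 2 ^ (k + 1) / 2
    rw [this, pow_succ, mul_div_assoc, div_self two_ne_zero, mul_one]
    exact (not_le.1 hjb).trans hk
  obtain ⟨P, hP⟩ := (hAc.inter_left isClosed_frontier).elim_finite_subcover O hOopen hcover
  -- the comparison function
  set T : ℂ → ℝ := fun z => ∑ p ∈ P, arcPotential (R p.1) (W (n p)) (F (n p) z) + δ * v z with hT
  have hTMV : HasMeanValueOn T U :=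
    (HasMeanValueOn.sum P fun p _ => hasMeanValueOn_arcPotential_comp hU (hW _)
      ((hF _).mono hUsub) (fun z hz => hF0 _ z (hne0 z hz)) (hFW _)).add (hvMV.const_mul δ)
  have hSnn : ∀ z ∈ U, ∀ p ∈ P, 0 ≤ arcPotential (R p.1) (W (n p)) (F (n p) z) :=
    fun z hz p _ => arcPotential_nonneg (hW _) (hR2 _) (hF0 _ z (hne0 z hz))
  have hT0 : T z₀ < m₀ := by
    have h1 : ∑ p ∈ P, arcPotential (R p.1) (W (n p)) (F (n p) z₀) ≤ η * Real.log 6 := by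
      calc _ ≤ ∑ p ∈ P, circleAngle (R p.1) (W (n p)) * Real.log 6 :=
            Finset.sum_le_sum fun p _ => arcPotential_le (hW _) (hR0 _) (hNge p.1 p.2)
        _ ≤ _ := by
            rw [← Finset.sum_mul]
            exact mul_le_mul_of_nonneg_right (hfin P) hlog6.le
    have h2 : η * Real.log 6 = m₀ / 4 := by
      rw [hη]; field_simp
    simp only [hT]
    linarith
  have hTO : ∀ z ∈ U, ∀ p ∈ P, z ∈ O p → m₀ ≤ T z := fun z hz p hp hzO => by
    have h1 := Finset.single_le_sum (hSnn z hz) hp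
    have h2 := le_arcPotential_of_norm_lt (hW (n p)) (hR0 p.1) (hF0 _ z (hne0 z hz)) hzO.2
    have h3 := mul_nonneg hδ.le (hv0 z hz)
    simp only [hT]
    linarith
  have hKA : {z | z ∈ U ∧ T z ≤ T z₀} ⊆ A := by
    rintro z ⟨hz, hzT⟩
    have h1 := Finset.sum_nonneg (hSnn z hz)
    have h2 : δ * v z ≤ m₀ := by
      simp only [hT] at hzT hT0
      linarith
    rw [mul_comm, ← le_div_iff₀ hδ, hvlog z hz] at h2
    have hza := norm_pos_iff.2 (hane z hz)
    have hz0 := norm_pos_iff.2 (hne0 z hz)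
    have h3 := (Real.log_le_iff_le_exp (by positivity)).1 h2
    change ‖z - a‖ ^ 2 ≤ D * ‖z‖
    rw [← div_le_iff₀ hz0, hD, le_div_iff₀ hCpos]
    linarith
  refine hTMV.not_isCompact_sublevel hU hz₀ (hAc.of_isClosed_subset ?_ hKA)
  refine isClosed_of_closure_subset fun z hz => ?_
  have hzA : z ∈ A := closure_minimal hKA hAc.isClosed hz
  by_cases hzU : z ∈ U
  · have hcl : ContinuousWithinAt T {z | z ∈ U ∧ T z ≤ T z₀} z :=
      (hTMV.1.continuousWithinAt hzU).mono fun w hw => hw.1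
    have : z ∈ T ⁻¹' Iic (T z₀) := by
      have := hcl.mem_closure hz (t := Iic (T z₀)) fun w hw => hw.2
      rwa [isClosed_Iic.closure_eq] at this
    exact ⟨hzU, this⟩
  · exfalso
    have hzfr : z ∈ frontier U := by
      rw [hU.frontier_eq]
      exact ⟨closure_mono (fun w hw => hw.1) hz, hzU⟩
    obtain ⟨p, hp, hzO⟩ := mem_iUnion₂.1 (hP ⟨hzfr, hzA⟩)
    obtain ⟨w, hwO, hwU, hwT⟩ := mem_closure_iff.1 hz (O p) (hOopen p) hzO
    exact absurd (hTO w hwU p hp hwO) (not_le.2 (hwT.trans_lt hT0))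

section cstar

variable {f : ℂ → ℂ}

lemma IsTranscendentalSelfMapCStar.ne_zero (hf : IsTranscendentalSelfMapCStar f) {z : ℂ}
    (hz : z ≠ 0) : f z ≠ 0 := by
  obtain ⟨m, g, h, -, -, -, -, hfz⟩ := hf
  rw [hfz z hz]
  exact mul_ne_zero (zpow_ne_zero m hz) (Complex.exp_ne_zero _)

lemma IsTranscendentalSelfMapCStar.differentiableAt (hf : IsTranscendentalSelfMapCStar f) {z : ℂ}
    (hz : z ≠ 0) : DifferentiableAt ℂ f z := by
  obtain ⟨m, g, h, hg, hh, -, -, hfz⟩ := hf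
  have : DifferentiableAt ℂ (fun z => z ^ m * Complex.exp (g z + h z⁻¹)) z :=
    (differentiableAt_zpow.2 (Or.inl hz)).mul
      ((hg z).add ((hh z⁻¹).comp z (differentiableAt_inv hz))).cexp
  refine this.congr_of_eventuallyEq ?_
  filter_upwards [isOpen_compl_singleton.mem_nhds hz] with w hw using hfz w hw

lemma IsTranscendentalSelfMapCStar.iterate_ne_zero (hf : IsTranscendentalSelfMapCStar f) (n : ℕ)
    {z : ℂ} (hz : z ≠ 0) : f^[n] z ≠ 0 := by
  induction n with
  | zero => exact hz
  | succ n ih => rw [iterate_succ_apply']; exact hf.ne_zero ih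

lemma IsTranscendentalSelfMapCStar.differentiableOn_iterate (hf : IsTranscendentalSelfMapCStar f)
    (n : ℕ) : DifferentiableOn ℂ f^[n] {0}ᶜ := by
  induction n with
  | zero => exact differentiableOn_id
  | succ n ih =>
    rw [iterate_succ']
    exact DifferentiableOn.comp (t := {0}ᶜ)
      (fun z hz => (hf.differentiableAt hz).differentiableWithinAt) ih
      fun z hz => hf.iterate_ne_zero n hz

/-- The `n`-th iterate of `f`, inverted if the itinerary `e` is at `0` at time `n`. -/
def signedIterate (f : ℂ → ℂ) (e : ℕ → Bool) (n : ℕ) (z : ℂ) : ℂ :=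
  if e n = true then f^[n] z else (f^[n] z)⁻¹

lemma mem_immediateLittleEscapingSet_iff (hf : IsTranscendentalSelfMapCStar f) {e : ℕ → Bool}
    {z : ℂ} (hz : z ≠ 0) : z ∈ immediateLittleEscapingSet f e ↔
      Tendsto (fun n => ‖signedIterate f e n z‖) atTop atTop := by
  have hpos : ∀ n, 0 < ‖f^[n] z‖ := fun n => norm_pos_iff.2 (hf.iterate_ne_zero n hz)
  constructor
  · rintro ⟨⟨-, hesc⟩, ℓ, hℓ⟩
    rw [tendsto_atTop]
    intro b
    obtain ⟨N, hN⟩ := hesc (|b| + 1)⁻¹ (by positivity)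
    filter_upwards [eventually_ge_atTop N, eventually_ge_atTop ℓ] with n hnN hnℓ
    have hcase := hN n hnN
    have hit := hℓ (n - ℓ)
    rw [Nat.sub_add_cancel hnℓ] at hit
    rw [one_div, inv_inv] at hcase
    have hb := le_abs_self b
    have hb0 := abs_nonneg b
    by_cases he : e n = true
    · have h1 : 1 < ‖f^[n] z‖ := hit.2 he
      rw [signedIterate, if_pos he]
      rcases hcase with h | h
      · have := inv_le_one_of_one_le₀ (show 1 ≤ |b| + 1 by linarith)
        linarith
      · linarith
    · have h1 : ‖f^[n] z‖ ≤ 1 := not_lt.1 fun h => he (hit.1 h)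
      rw [signedIterate, if_neg he, norm_inv]
      rcases hcase with h | h
      · have := (lt_inv_comm₀ (hpos n) (by positivity)).1 h
        linarith
      · linarith
  · intro h
    refine ⟨⟨hz, fun ε hε => ?_⟩, ?_⟩
    · obtain ⟨N, hN⟩ := eventually_atTop.1 (h.eventually_gt_atTop (1 / ε))
      refine ⟨N, fun n hn => ?_⟩
      have hlt := hN n hn
      by_cases he : e n = true
      · rw [signedIterate, if_pos he] at hlt
        exact Or.inr hlt
      · rw [signedIterate, if_neg he, norm_inv, one_div] at hlt
        exact Or.inl ((inv_lt_inv₀ hε (hpos n)).1 hlt)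
    · obtain ⟨N, hN⟩ := eventually_atTop.1 (h.eventually_gt_atTop 1)
      refine ⟨N, fun n => ?_⟩
      have hlt := hN (n + N) (Nat.le_add_left N n)
      by_cases he : e (n + N) = true
      · rw [signedIterate, if_pos he] at hlt
        exact iff_of_true hlt he
      · rw [signedIterate, if_neg he, norm_inv] at hlt
        exact iff_of_false (not_lt.2 ((one_lt_inv₀ (hpos _)).1 hlt).le) he

lemma immediateLittleEscapingSet_subset (f : ℂ → ℂ) (e : ℕ → Bool) :
    immediateLittleEscapingSet f e ⊆ littleEscapingSet f e :=
  fun _ ⟨h, ℓ, hℓ⟩ => ⟨h, ℓ, ℓ, hℓ⟩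

lemma isOpen_FatouSet (f : ℂ → ℂ) : IsOpen (FatouSet f) := by
  refine isOpen_iff_forall_mem_open.2 ?_
  rintro z ⟨-, U, hU, hzU, hU0, heq⟩
  exact ⟨U, fun w hw => ⟨hU0 w hw, U, hU, hw, hU0, heq⟩, hU, hzU⟩

lemma IsFatouComponent.isOpen {U : Set ℂ} (hU : IsFatouComponent f U) : IsOpen U := by
  obtain ⟨z, -, rfl⟩ := hU
  exact (isOpen_FatouSet f).connectedComponentIn

lemma IsFatouComponent.nonempty {U : Set ℂ} (hU : IsFatouComponent f U) : U.Nonempty := by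
  obtain ⟨z, hz, rfl⟩ := hU
  exact ⟨z, mem_connectedComponentIn hz⟩

lemma IsFatouComponent.zero_notMem {U : Set ℂ} (hU : IsFatouComponent f U) : (0 : ℂ) ∉ U := by
  obtain ⟨z, -, rfl⟩ := hU
  exact fun h => (connectedComponentIn_subset _ _ h).1 rfl

lemma IsFatouComponent.disjoint {U V : Set ℂ} (hU : IsFatouComponent f U)
    (hV : IsFatouComponent f V) (hne : U ≠ V) : Disjoint U V := by
  obtain ⟨z, -, rfl⟩ := hU
  obtain ⟨w, -, rfl⟩ := hV
  refine Set.disjoint_left.2 fun x hx hx' => hne ?_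
  rw [connectedComponentIn_eq hx, connectedComponentIn_eq hx']

end cstar

/-- If `U` is a wandering domain of a transcendental self-map `f` of `ℂ*`
with `U ⊆ Ĩ_e(f)`, then `∂U ∩ Ĩ_e(f) ≠ ∅` (boundary taken in `ℂ*`); in particular
`∂U ∩ I_e(f) ≠ ∅`. -/
theorem wandering_domain_boundary_meets_immediateLittleEscapingSet (f : ℂ → ℂ)
    (hf : IsTranscendentalSelfMapCStar f) (e : ℕ → Bool) (U : Set ℂ)
    (hU : IsWanderingDomain f U) (hUe : U ⊆ immediateLittleEscapingSet f e) :
    (boundaryInCStar U ∩ immediateLittleEscapingSet f e).Nonempty ∧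
    (boundaryInCStar U ∩ littleEscapingSet f e).Nonempty := by
  obtain ⟨hUc, V, rfl, hVc, hVf, hVinj⟩ := hU
  suffices h : (boundaryInCStar (V 0) ∩ immediateLittleEscapingSet f e).Nonempty from
    ⟨h, h.mono (inter_subset_inter_right _ (immediateLittleEscapingSet_subset f e))⟩
  have hV0 : ∀ n, ∀ z ∈ V n, z ≠ 0 := fun n z hz h => (hVc n).zero_notMem (h ▸ hz)
  have hVd : Pairwise (Function.onFun Disjoint V) := fun i j hij =>
    (hVc i).disjoint (hVc j) (hVinj.ne hij)
  have hiter : ∀ n, MapsTo f^[n] (V 0) (V n) := by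
    intro n
    induction n with
    | zero => exact mapsTo_id _
    | succ n ih =>
      rw [iterate_succ']
      exact fun z hz => hVf n (mem_image_of_mem f (ih hz))
  have hinv : ∀ n, IsOpen ({0}ᶜ ∩ Inv.inv ⁻¹' V n) := fun n =>
    continuousOn_inv₀.isOpen_inter_preimage isOpen_compl_singleton (hVc n).isOpen
  have hinvd : Pairwise (Function.onFun Disjoint fun n => ({0}ᶜ ∩ Inv.inv ⁻¹' V n : Set ℂ)) :=
    fun i j hij => Set.disjoint_left.2 fun w hw hw' => Set.disjoint_left.1 (hVd hij) hw.2 hw'.2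
  obtain ⟨a, haV⟩ := (hVc 1).nonempty
  obtain ⟨r, hr, hrV⟩ := Metric.isOpen_iff.1 (hVc 1).isOpen a haV
  suffices h : ∃ ζ ∈ frontier (V 0), ζ ≠ 0 ∧
      Tendsto (fun n => ‖signedIterate f e n ζ‖) atTop atTop by
    obtain ⟨ζ, hζ, hζ0, hζt⟩ := h
    exact ⟨ζ, ⟨hζ, hζ0⟩, (mem_immediateLittleEscapingSet_iff hf hζ0).2 hζt⟩
  refine exists_mem_frontier_tendsto_norm_atTop (F := signedIterate f e)
    (W := fun n => if e n = true then V n else {0}ᶜ ∩ Inv.inv ⁻¹' V n)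
    hUc.isOpen hUc.nonempty hUc.zero_notMem (hV0 1 a haV) hr
    ((hVd one_ne_zero).mono_left hrV) ?_ ?_ ?_ ?_ ?_ ?_
  · intro n
    refine DifferentiableOn.analyticOnNhd ?_ isOpen_compl_singleton
    unfold signedIterate
    split_ifs
    · exact hf.differentiableOn_iterate n
    · exact (hf.differentiableOn_iterate n).fun_inv fun z hz => hf.iterate_ne_zero n hz
  · intro n z hz
    unfold signedIterate
    split_ifs
    · exact hf.iterate_ne_zero n hz
    · exact inv_ne_zero (hf.iterate_ne_zero n hz)
  · intro n
    split_ifs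
    · exact (hVc n).isOpen
    · exact hinv n
  · intro n z hz
    have hne := hf.iterate_ne_zero n (hV0 0 z hz)
    unfold signedIterate
    split_ifs
    · exact hiter n hz
    · refine ⟨inv_ne_zero hne, ?_⟩
      rw [mem_preimage, inv_inv]
      exact hiter n hz
  · intro R
    have hle : ∀ n, MeasureTheory.volume (circleAngles R
        (if e n = true then V n else {0}ᶜ ∩ Inv.inv ⁻¹' V n)) ≤
        MeasureTheory.volume (circleAngles R (V n)) +
          MeasureTheory.volume (circleAngles R ({0}ᶜ ∩ Inv.inv ⁻¹' V n)) := by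
      intro n
      split_ifs
      · exact le_self_add
      · exact le_add_self
    refine ne_top_of_le_ne_top ?_ (ENNReal.tsum_le_tsum hle)
    rw [ENNReal.tsum_add]
    exact ENNReal.add_ne_top.2
      ⟨ne_top_of_le_ne_top ENNReal.ofReal_ne_top
        (tsum_volume_circleAngles_le (fun n => (hVc n).isOpen) hVd R),
      ne_top_of_le_ne_top ENNReal.ofReal_ne_top (tsum_volume_circleAngles_le hinv hinvd R)⟩
  · exact fun z hz => (mem_immediateLittleEscapingSet_iff hf (hV0 0 z hz)).1 (hUe hz)
end
end

section
/- Let f be a transcendental self-map of ℂ*, let U be a Fatou component of f, and let e ∈ {0,∞}^ℕ. If U ∩ Ĩ_e(f) ≠ ∅, then U ⊆ Ĩ_e(f). -/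
open Complex Topology Filter Set Function OnePoint

noncomputable section

/-- A nonvanishing holomorphic function on a disc has a holomorphic logarithm. -/
lemma exists_holomorphic_log_on_ball {G : ℂ → ℂ} {c : ℂ} {r : ℝ} (hr : 0 < r)
    (hG : DifferentiableOn ℂ G (Metric.ball c r)) (h0 : ∀ z ∈ Metric.ball c r, G z ≠ 0) :
    ∃ L : ℂ → ℂ, DifferentiableOn ℂ L (Metric.ball c r) ∧
      ∀ z ∈ Metric.ball c r, G z = Complex.exp (L z) := by
  have hdiff : DifferentiableOn ℂ (fun z => deriv G z / G z) (Metric.ball c r) :=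
    (hG.deriv Metric.isOpen_ball).div hG h0
  obtain ⟨P, hP⟩ := hdiff.isExactOn_ball
  have hc : c ∈ Metric.ball c r := Metric.mem_ball_self hr
  have hq : ∀ z ∈ Metric.ball c r,
      HasDerivAt (fun z => G z * Complex.exp (-P z)) 0 z := by
    intro z hz
    have hGz : HasDerivAt G (deriv G z) z :=
      (hG.differentiableAt (Metric.isOpen_ball.mem_nhds hz)).hasDerivAt
    have hz0 := h0 z hz
    refine (hGz.mul (hP z hz).neg.cexp).congr_deriv ?_
    simp only [Pi.neg_apply]
    field_simp
    ring
  have hconst : ∀ z ∈ Metric.ball c r,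
      G z * Complex.exp (-P z) = G c * Complex.exp (-P c) := fun z hz =>
    Metric.isOpen_ball.is_const_of_deriv_eq_zero (convex_ball c r).isPreconnected
      (fun w hw => (hq w hw).differentiableAt.differentiableWithinAt)
      (fun w hw => (hq w hw).deriv) hz hc
  refine ⟨fun z => P z + (Complex.log (G c) - P c),
    fun z hz => ((hP z hz).differentiableAt.add_const _).differentiableWithinAt, fun z hz => ?_⟩
  have h1 : Complex.exp (Complex.log (G c) - P c) = G z * Complex.exp (-P z) := by
    rw [hconst z hz, sub_eq_add_neg, Complex.exp_add, Complex.exp_log (h0 c hc)]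
  rw [Complex.exp_add, h1, mul_left_comm, ← Complex.exp_add]
  simp

/-- A Harnack-type inequality for nonvanishing holomorphic functions into the unit disc. -/
lemma norm_center_pow_three_le {G : ℂ → ℂ} {a b : ℂ} {r : ℝ} (hr : 0 < r)
    (hG : DifferentiableOn ℂ G (Metric.ball b r)) (h0 : ∀ z ∈ Metric.ball b r, G z ≠ 0)
    (h1 : ∀ z ∈ Metric.ball b r, ‖G z‖ ≤ 1) (hab : dist a b ≤ r / 2) :
    ‖G b‖ ^ 3 ≤ Real.exp 2 * ‖G a‖ := by
  obtain ⟨L, hL, hGL⟩ := exists_holomorphic_log_on_ball hr hG h0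
  have hb : b ∈ Metric.ball b r := Metric.mem_ball_self hr
  have ha : a ∈ Metric.ball b r := by rw [Metric.mem_ball]; linarith
  have hnorm : ∀ z ∈ Metric.ball b r, ‖G z‖ = Real.exp (L z).re := fun z hz => by
    rw [hGL z hz, Complex.norm_exp]
  have hre : ∀ z ∈ Metric.ball b r, (L z).re ≤ 0 := fun z hz => by
    have := h1 z hz
    rwa [hnorm z hz, Real.exp_le_one_iff] at this
  have hmaps : MapsTo (fun w => b + w) (Metric.ball 0 r) (Metric.ball b r) := fun w hw => by
    simpa [Metric.mem_ball, dist_eq_norm] using hw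
  have hab' : ‖a - b‖ ≤ r / 2 := by rwa [← dist_eq_norm]
  have key := Complex.borelCaratheodory (f := fun w => L (b + w) - ((L b).im : ℂ) * Complex.I)
    (M := 1) (R := r) (z := a - b) one_pos
    ((hL.comp (by fun_prop) hmaps).sub_const _)
    (fun w hw => by
      have := hre _ (hmaps hw)
      simp
      linarith) hr (by rw [mem_ball_zero_iff]; linarith)
  have hLb : L b - ((L b).im : ℂ) * Complex.I = ((L b).re : ℂ) := by
    apply Complex.ext <;> simp
  simp only [add_sub_cancel, add_zero, hLb, Complex.norm_real, Real.norm_eq_abs,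
    abs_of_nonpos (hre b hb)] at key
  have hden : 0 < r - ‖a - b‖ := by linarith
  have hb1 : 2 * 1 * ‖a - b‖ / (r - ‖a - b‖) ≤ 2 := by
    rw [div_le_iff₀ hden]; linarith
  have hb2 : -(L b).re * (r + ‖a - b‖) / (r - ‖a - b‖) ≤ 3 * -(L b).re := by
    rw [div_le_iff₀ hden]
    nlinarith [mul_nonneg (neg_nonneg.2 (hre b hb)) (sub_nonneg.2 hab')]
  have hlow : -(L a).re ≤ ‖L a - ((L b).im : ℂ) * Complex.I‖ := by
    have := (neg_le_abs _).trans (Complex.abs_re_le_norm (L a - ((L b).im : ℂ) * Complex.I))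
    simpa using this
  rw [hnorm a ha, hnorm b hb, ← Real.exp_nat_mul, ← Real.exp_add, Real.exp_le_exp]
  push_cast
  linarith

lemma chordalDist_comm (z w : ℂ) : chordalDist z w = chordalDist w z := by
  rw [chordalDist, chordalDist, norm_sub_rev, mul_comm]

lemma chordalDist_le_dist (z w : ℂ) : chordalDist z w ≤ dist z w := by
  rw [chordalDist, dist_eq_norm]
  refine div_le_self (norm_nonneg _) (Real.one_le_sqrt.2 ?_)
  nlinarith [sq_nonneg ‖z‖, sq_nonneg ‖w‖, mul_nonneg (sq_nonneg ‖z‖) (sq_nonneg ‖w‖)]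

lemma one_tenth_le_chordalDist {z w : ℂ} (hzw : 2 * ‖z‖ ≤ ‖w‖)
    (h : (‖z‖ ≤ 2 ∧ 1 ≤ ‖w‖) ∨ (‖z‖ ≤ 1 ∧ 1 / 2 ≤ ‖w‖)) : 1 / 10 ≤ chordalDist z w := by
  have hz := norm_nonneg z
  have hprod : (1 + ‖z‖ ^ 2) * (1 + ‖w‖ ^ 2) ≤ 10 * ‖w‖ ^ 2 := by
    rcases h with ⟨h1, h2⟩ | ⟨h1, h2⟩
    · calc (1 + ‖z‖ ^ 2) * (1 + ‖w‖ ^ 2) ≤ 5 * (2 * ‖w‖ ^ 2) := by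
            gcongr <;> nlinarith
        _ = _ := by ring
    · calc (1 + ‖z‖ ^ 2) * (1 + ‖w‖ ^ 2) ≤ 2 * (5 * ‖w‖ ^ 2) := by
            gcongr <;> nlinarith
        _ = _ := by ring
  have hsub : ‖w‖ - ‖z‖ ≤ ‖z - w‖ := by
    rw [norm_sub_rev]; exact norm_sub_norm_le w z
  rw [chordalDist, le_div_iff₀ (by positivity)]
  have hsqrt : Real.sqrt ((1 + ‖z‖ ^ 2) * (1 + ‖w‖ ^ 2)) ≤ 5 * ‖w‖ :=
    Real.sqrt_le_iff.2 ⟨by positivity, by nlinarith [sq_nonneg ‖w‖]⟩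
  linarith

namespace IsTranscendentalSelfMapCStar

variable {f : ℂ → ℂ}

lemma differentiableAt_s8 (hf : IsTranscendentalSelfMapCStar f) {z : ℂ} (hz : z ≠ 0) :
    DifferentiableAt ℂ f z := by
  obtain ⟨m, g, h, hg, hh, -, -, hfz⟩ := hf
  have hF : DifferentiableAt ℂ (fun z => z ^ m * Complex.exp (g z + h z⁻¹)) z :=
    (differentiableAt_zpow.2 (Or.inl hz)).mul
      ((hg z).add ((hh z⁻¹).comp z (differentiableAt_inv hz))).cexp
  refine hF.congr_of_eventuallyEq ?_
  filter_upwards [isOpen_ne.mem_nhds hz] with w hw using hfz w hw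

lemma iterate_ne_zero_s8 (hf : IsTranscendentalSelfMapCStar f) {z : ℂ} (hz : z ≠ 0) (n : ℕ) :
    f^[n] z ≠ 0 := by
  induction n with
  | zero => exact hz
  | succ n ih =>
    obtain ⟨m, g, h, -, -, -, -, hfz⟩ := hf
    rw [iterate_succ_apply', hfz _ ih]
    exact mul_ne_zero (zpow_ne_zero _ ih) (Complex.exp_ne_zero _)

lemma differentiableAt_iterate (hf : IsTranscendentalSelfMapCStar f) {z : ℂ} (hz : z ≠ 0)
    (n : ℕ) : DifferentiableAt ℂ f^[n] z := by
  induction n with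
  | zero => exact differentiableAt_id
  | succ n ih =>
    rw [iterate_succ']
    exact (hf.differentiableAt_s8 (hf.iterate_ne_zero_s8 hz n)).comp z ih

/-- If an iterate of `f` stays on one side of the unit circle throughout a disc, closeness
to `0` or `∞` propagates inside it. -/
lemma near_ends_of_near_ends (hf : IsTranscendentalSelfMapCStar f) {b : ℂ} {r : ℝ} (hr : 0 < r)
    (hball : ∀ w ∈ Metric.ball b r, w ≠ 0) {n : ℕ}
    (hside : (∀ w ∈ Metric.ball b r, ‖f^[n] w‖ < 1) ∨ ∀ w ∈ Metric.ball b r, 1 < ‖f^[n] w‖)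
    {a : ℂ} (hab : dist a b ≤ r / 2) {ε δ : ℝ} (hε : 0 < ε) (hδ : 0 < δ) (hδ1 : δ ≤ 1)
    (hδε : Real.exp 2 * δ ≤ ε ^ 3) (ha : ‖f^[n] a‖ < δ ∨ 1 / δ < ‖f^[n] a‖) :
    ‖f^[n] b‖ < ε ∨ 1 / ε < ‖f^[n] b‖ := by
  have hdiff : DifferentiableOn ℂ f^[n] (Metric.ball b r) := fun w hw =>
    (hf.differentiableAt_iterate (hball w hw) n).differentiableWithinAt
  have hne : ∀ w ∈ Metric.ball b r, f^[n] w ≠ 0 := fun w hw => hf.iterate_ne_zero_s8 (hball w hw) n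
  have haB : a ∈ Metric.ball b r := by rw [Metric.mem_ball]; linarith
  have hbB : b ∈ Metric.ball b r := Metric.mem_ball_self hr
  have hexp := Real.exp_pos 2
  rcases hside with hs | hs
  · left
    have ha' : ‖f^[n] a‖ < δ := ha.resolve_right fun h =>
      absurd ((one_le_one_div hδ hδ1).trans_lt h) (hs a haB).not_gt
    have := norm_center_pow_three_le hr hdiff hne (fun w hw => (hs w hw).le) hab
    exact lt_of_pow_lt_pow_left₀ 3 hε.le (by nlinarith)
  · right
    have ha' : 1 / δ < ‖f^[n] a‖ := ha.resolve_left fun h => by linarith [hs a haB]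
    have := norm_center_pow_three_le (G := fun w => (f^[n] w)⁻¹) hr (hdiff.inv hne)
      (fun w hw => inv_ne_zero (hne w hw))
      (fun w hw => by rw [norm_inv]; exact inv_le_one_of_one_le₀ (hs w hw).le) hab
    have hδ' : ‖(f^[n] a)⁻¹‖ < δ := by
      rw [norm_inv]
      exact inv_lt_of_inv_lt₀ hδ (by rwa [← one_div])
    have hlt : ‖(f^[n] b)⁻¹‖ < ε := lt_of_pow_lt_pow_left₀ 3 hε.le (by nlinarith)
    rw [norm_inv] at hlt
    rw [one_div]
    exact inv_lt_of_inv_lt₀ (by linarith [hs b hbB]) hlt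

/-- Near a Fatou point, membership in `Ĩ_e(f)` is locally constant. -/
lemma exists_ball_immediateLittleEscapingSet (hf : IsTranscendentalSelfMapCStar f) (e : ℕ → Bool)
    {z : ℂ} (hz : z ∈ FatouSet f) :
    ∃ r > 0, ∀ a ∈ Metric.ball z r, ∀ b ∈ Metric.ball z r,
      a ∈ immediateLittleEscapingSet f e → b ∈ immediateLittleEscapingSet f e := by
  obtain ⟨-, V, hVo, hzV, hV0, hequi⟩ := hz
  obtain ⟨δ, hδ, hclose⟩ := hequi z hzV (1 / 10) (by norm_num)
  obtain ⟨s, hs, hsV⟩ := Metric.isOpen_iff.1 hVo z hzV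
  obtain ⟨R, hR, hRs, hRδ⟩ : ∃ R > 0, R ≤ s ∧ R ≤ δ :=
    ⟨min s δ, lt_min hs hδ, min_le_left _ _, min_le_right _ _⟩
  have hRV : Metric.ball z R ⊆ V := (Metric.ball_subset_ball hRs).trans hsV
  have hnear : ∀ w ∈ Metric.ball z R, ∀ n, chordalDist (f^[n] z) (f^[n] w) < 1 / 10 :=
    fun w hw => hclose w (hRV hw) ((chordalDist_le_dist z w).trans_lt
      ((Metric.mem_ball'.1 hw).trans_le hRδ))
  have hsmall : ∀ n, ∀ a ∈ Metric.ball z R, ‖f^[n] a‖ < 1 / 4 →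
      ∀ w ∈ Metric.ball z R, ‖f^[n] w‖ < 1 := by
    intro n a ha han w hw
    have hc : ‖f^[n] z‖ < 1 / 2 := by
      by_contra! h
      have := one_tenth_le_chordalDist (z := f^[n] a) (w := f^[n] z) (by linarith)
        (Or.inr ⟨by linarith, h⟩)
      rw [chordalDist_comm] at this
      linarith [hnear a ha n]
    by_contra! h
    linarith [hnear w hw n, one_tenth_le_chordalDist (z := f^[n] z) (w := f^[n] w) (by linarith)
      (Or.inl ⟨by linarith, h⟩)]
  have hlarge : ∀ n, ∀ a ∈ Metric.ball z R, 4 < ‖f^[n] a‖ →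
      ∀ w ∈ Metric.ball z R, 1 < ‖f^[n] w‖ := by
    intro n a ha han w hw
    have hc : 2 < ‖f^[n] z‖ := by
      by_contra! h
      linarith [hnear a ha n, one_tenth_le_chordalDist (z := f^[n] z) (w := f^[n] a) (by linarith)
        (Or.inl ⟨h, by linarith⟩)]
    by_contra! h
    have := one_tenth_le_chordalDist (z := f^[n] w) (w := f^[n] z) (by linarith)
      (Or.inr ⟨h, by linarith⟩)
    rw [chordalDist_comm] at this
    linarith [hnear w hw n]
  have hside : ∀ n, ∀ a ∈ Metric.ball z R, (‖f^[n] a‖ < 1 / 4 ∨ 1 / (1 / 4) < ‖f^[n] a‖) →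
      (∀ w ∈ Metric.ball z R, ‖f^[n] w‖ < 1) ∨ ∀ w ∈ Metric.ball z R, 1 < ‖f^[n] w‖ :=
    fun n a ha h => h.imp (hsmall n a ha) fun h => hlarge n a ha (by norm_num at h; exact h)
  refine ⟨R / 5, by positivity, ?_⟩
  rintro a ha b hb ⟨⟨-, hesc⟩, ℓ, hℓ⟩
  have hsub : Metric.ball z (R / 5) ⊆ Metric.ball z R := Metric.ball_subset_ball (by linarith)
  have hsubb : Metric.ball b (4 * R / 5) ⊆ Metric.ball z R :=
    Metric.ball_subset_ball' (by linarith [Metric.mem_ball.1 hb])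
  have hab : dist a b ≤ (4 * R / 5) / 2 := by
    linarith [dist_triangle_right a b z, Metric.mem_ball.1 ha, Metric.mem_ball.1 hb]
  obtain ⟨N, hN⟩ := hesc (1 / 4) (by norm_num)
  refine ⟨⟨hV0 b (hRV (hsub hb)), fun ε hε => ?_⟩, max N ℓ, fun n => ?_⟩
  · have hexp := Real.exp_pos 2
    have hη : 0 < min 1 (ε ^ 3 / Real.exp 2) := lt_min one_pos (by positivity)
    obtain ⟨K, hK⟩ := hesc _ hη
    refine ⟨max N K, fun n hn => ?_⟩
    refine hf.near_ends_of_near_ends (by positivity) (fun w hw => hV0 w (hRV (hsubb hw)))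
      ((hside n a (hsub ha) (hN n (le_of_max_le_left hn))).imp (fun h w hw => h w (hsubb hw))
        fun h w hw => h w (hsubb hw)) hab hε hη (min_le_left _ _) ?_
      (hK n (le_of_max_le_right hn))
    rw [mul_comm]
    exact (le_div_iff₀ hexp).1 (min_le_right _ _)
  · obtain ⟨k, hk⟩ : ∃ k, n + max N ℓ = k + ℓ := ⟨n + max N ℓ - ℓ, by omega⟩
    have hsame := hℓ k
    rw [← hk] at hsame
    rw [← hsame]
    rcases hside _ a (hsub ha) (hN (n + max N ℓ) (by omega)) with h | h
    · exact iff_of_false (h b (hsub hb)).not_gt (h a (hsub ha)).not_gt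
    · exact iff_of_true (h b (hsub hb)) (h a (hsub ha))

end IsTranscendentalSelfMapCStar

/-- If a Fatou component `U` of a transcendental self-map `f` of `ℂ*`
meets `Ĩ_e(f)`, then `U ⊆ Ĩ_e(f)`. -/
theorem fatouComponent_meets_immediateLittleEscapingSet (f : ℂ → ℂ)
    (hf : IsTranscendentalSelfMapCStar f) (U : Set ℂ) (hU : IsFatouComponent f U)
    (e : ℕ → Bool) (hmeets : (U ∩ immediateLittleEscapingSet f e).Nonempty) :
    U ⊆ immediateLittleEscapingSet f e := by
  obtain ⟨z₀, -, rfl⟩ := hU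
  have hloc : ∀ z ∈ connectedComponentIn (FatouSet f) z₀, ∃ r > 0,
      ∀ a ∈ Metric.ball z r, ∀ b ∈ Metric.ball z r,
        a ∈ immediateLittleEscapingSet f e → b ∈ immediateLittleEscapingSet f e :=
    fun z hz => hf.exists_ball_immediateLittleEscapingSet e (connectedComponentIn_subset _ _ hz)
  have hsub := (isPreconnected_connectedComponentIn (F := FatouSet f) (x := z₀)).subset_left_of_subset_union
    (isOpen_interior (s := immediateLittleEscapingSet f e))
    (isOpen_interior (s := (immediateLittleEscapingSet f e)ᶜ))
    (disjoint_compl_right.mono interior_subset interior_subset) (fun z hz => ?_) ?_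
  · exact hsub.trans interior_subset
  · obtain ⟨r, hr, h⟩ := hloc z hz
    by_cases hze : z ∈ immediateLittleEscapingSet f e
    · exact Or.inl (mem_interior_iff_mem_nhds.2 (Filter.mem_of_superset (Metric.ball_mem_nhds z hr)
        fun b hb => h z (Metric.mem_ball_self hr) b hb hze))
    · exact Or.inr (mem_interior_iff_mem_nhds.2 (Filter.mem_of_superset (Metric.ball_mem_nhds z hr)
        fun b hb hbe => hze (h b hb z (Metric.mem_ball_self hr) hbe)))
  · obtain ⟨w, hw, hwe⟩ := hmeets
    obtain ⟨r, hr, h⟩ := hloc w hw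
    exact ⟨w, hw, mem_interior_iff_mem_nhds.2 (Filter.mem_of_superset (Metric.ball_mem_nhds w hr)
      fun b hb => h w (Metric.mem_ball_self hr) b hb hwe)⟩
end
end
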